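/- arXiv:1103.1724 — 2 statements merged into one kernel-verified Lean document; each statement's English description precedes it below -/
import Mathlib

section
/- Let A and B be commuting bounded self-adjoint operators on a complex Hilbert space H with A² + B² = 1 (the identity), and let ψ ∈ H be a unit vector with Aψ ≠ 0 and Bψ ≠ 0. Set p = ‖Aψ‖² and q = ‖Bψ‖² (so p + q = 1), and let ψ_A = Aψ/‖Aψ‖ and ψ_B = Bψ/‖Bψ‖. Then p·(‖A ψ_A‖⁴ + ‖B ψ_A‖⁴) + q·(‖A ψ_B‖⁴ + ‖B ψ_B‖⁴) − (p² + q²) = 2·(‖A²ψ‖² − p²)² / (p·q). In particular the left-hand side is nonnegative. -/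
/-- A pair of self-adjoint Kraus operators preserves the total squared norm. -/
theorem norm_sq_add_norm_sq_of_sq_add_sq_eq_one
    {H : Type*} [NormedAddCommGroup H] [InnerProductSpace ℂ H] [CompleteSpace H]
    {A B : H →L[ℂ] H} (hA : IsSelfAdjoint A) (hB : IsSelfAdjoint B)
    (hone : A.comp A + B.comp B = 1) (φ : H) :
    ‖A φ‖ ^ 2 + ‖B φ‖ ^ 2 = ‖φ‖ ^ 2 := by
  have norm_sq_apply {T : H →L[ℂ] H} (hT : IsSelfAdjoint T) :
      ‖T φ‖ ^ 2 = RCLike.re (inner ℂ (T (T φ)) φ) := by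
    rw [← inner_self_eq_norm_sq (𝕜 := ℂ)]
    exact congrArg _ (hT.isSymmetric (T φ) φ).symm
  have hφ : A (A φ) + B (B φ) = φ := DFunLike.congr_fun hone φ
  rw [norm_sq_apply hA, norm_sq_apply hB, ← map_add, ← inner_add_left, hφ,
    inner_self_eq_norm_sq]

/-- The fourth power of the norm of an operator applied to a normalized vector. -/
theorem norm_apply_inv_norm_smul_pow_four
    {H : Type*} [NormedAddCommGroup H] [InnerProductSpace ℂ H]
    (T : H →L[ℂ] H) (φ : H) :
    ‖T ((‖φ‖ : ℂ)⁻¹ • φ)‖ ^ 4 = (‖T φ‖ ^ 2 / ‖φ‖ ^ 2) ^ 2 := by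
  rw [map_smul, norm_smul, norm_inv, Complex.norm_real, norm_norm]
  ring

/-- exact expression for the conditional expectation increment of the
measured quantity ‖Aφ‖⁴ + ‖Bφ‖⁴ under a QND measurement with commuting self-adjoint
Kraus operators A, B satisfying A² + B² = 1. -/
theorem qnd_measurement_increment
    {H : Type*} [NormedAddCommGroup H] [InnerProductSpace ℂ H] [CompleteSpace H]
    (A B : H →L[ℂ] H) (hA : IsSelfAdjoint A) (hB : IsSelfAdjoint B)
    (hcomm : A.comp B = B.comp A) (hone : A.comp A + B.comp B = 1)
    (ψ : H) (hψ : ‖ψ‖ = 1) (hAψ : A ψ ≠ 0) (hBψ : B ψ ≠ 0)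
    (p q : ℝ) (hp : p = ‖A ψ‖ ^ 2) (hq : q = ‖B ψ‖ ^ 2)
    (ψA ψB : H)
    (hψA : ψA = ((‖A ψ‖ : ℂ))⁻¹ • A ψ) (hψB : ψB = ((‖B ψ‖ : ℂ))⁻¹ • B ψ) :
    p * (‖A ψA‖ ^ 4 + ‖B ψA‖ ^ 4) + q * (‖A ψB‖ ^ 4 + ‖B ψB‖ ^ 4) - (p ^ 2 + q ^ 2)
      = 2 * (‖A (A ψ)‖ ^ 2 - p ^ 2) ^ 2 / (p * q) ∧
    0 ≤ p * (‖A ψA‖ ^ 4 + ‖B ψA‖ ^ 4) + q * (‖A ψB‖ ^ 4 + ‖B ψB‖ ^ 4)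
        - (p ^ 2 + q ^ 2) := by
  have hp_pos : 0 < p := hp ▸ pow_pos (norm_pos_iff.mpr hAψ) 2
  have hq_pos : 0 < q := hq ▸ pow_pos (norm_pos_iff.mpr hBψ) 2
  have norm_split := norm_sq_add_norm_sq_of_sq_add_sq_eq_one hA hB hone
  have hAB : A (B ψ) = B (A ψ) := DFunLike.congr_fun hcomm ψ
  have hpq : q = 1 - p := by
    have h := norm_split ψ
    rw [← hp, ← hq, hψ] at h
    linarith
  have hBA : ‖B (A ψ)‖ ^ 2 = p - ‖A (A ψ)‖ ^ 2 := by
    linarith [norm_split (A ψ)]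
  have hBB : ‖B (B ψ)‖ ^ 2 = q - p + ‖A (A ψ)‖ ^ 2 := by
    have h := norm_split (B ψ)
    rw [hAB] at h
    linarith
  have increment : p * (‖A ψA‖ ^ 4 + ‖B ψA‖ ^ 4) + q * (‖A ψB‖ ^ 4 + ‖B ψB‖ ^ 4)
      - (p ^ 2 + q ^ 2) = 2 * (‖A (A ψ)‖ ^ 2 - p ^ 2) ^ 2 / (p * q) := by
    rw [hψA, hψB]
    simp only [norm_apply_inv_norm_smul_pow_four]
    rw [hAB, hBA, hBB, ← hp, ← hq]
    generalize ‖A (A ψ)‖ ^ 2 = a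
    have hp_ne := hp_pos.ne'
    have hq_ne := hq_pos.ne'
    field_simp
    rw [hpq]
    ring
  refine ⟨increment, ?_⟩
  rw [increment]
  positivity
end

section
/- Let ψ ∈ ℓ²(ℕ,ℂ) be a unit vector such that ‖M_g² ψ‖² = ‖M_g ψ‖⁴, and assume the values cos²(θ+nφ), n ∈ ℕ, are pairwise distinct. Then ψ is a Fock state: there exist n ∈ ℕ and c ∈ ℂ with |c| = 1 such that ψ = c·e_n. -/
/-- A probability weight `p` on `ι` for which a bounded function `a` has zero variance is
concentrated on the level set of `a` at its mean. -/
theorem eq_tsum_or_eq_zero_of_tsum_sq_eq {ι : Type*} {a p : ι → ℝ} {C : ℝ}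
    (ha : ∀ i, |a i| ≤ C) (hp : ∀ i, 0 ≤ p i) (hsum : HasSum p 1)
    (heq : ∑' i, a i ^ 2 * p i = (∑' i, a i * p i) ^ 2) (i : ι) :
    a i = ∑' j, a j * p j ∨ p i = 0 := by
  have h1 : Summable fun i => a i * p i := by
    refine Summable.of_norm_bounded (hsum.summable.mul_left C) fun i => ?_
    rw [norm_mul, Real.norm_eq_abs, Real.norm_of_nonneg (hp i)]
    exact mul_le_mul_of_nonneg_right (ha i) (hp i)
  have h2 : Summable fun i => a i ^ 2 * p i := by
    refine Summable.of_norm_bounded (hsum.summable.mul_left (C ^ 2)) fun i => ?_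
    rw [norm_mul, norm_pow, Real.norm_eq_abs, Real.norm_of_nonneg (hp i)]
    exact mul_le_mul_of_nonneg_right (pow_le_pow_left₀ (abs_nonneg _) (ha i) 2) (hp i)
  set m := ∑' j, a j * p j with hm
  have hvar : HasSum (fun i => (a i - m) ^ 2 * p i) 0 := by
    have h := (h2.hasSum.sub (h1.hasSum.mul_left (2 * m))).add (hsum.mul_left (m ^ 2))
    rw [heq, ← hm, show m ^ 2 - 2 * m * m + m ^ 2 * 1 = 0 by ring] at h
    have hfun : (fun i => (a i - m) ^ 2 * p i) =
        fun i => a i ^ 2 * p i - 2 * m * (a i * p i) + m ^ 2 * p i := by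
      ext i
      ring
    rwa [hfun]
  have hzero := congrFun ((hasSum_zero_iff_of_nonneg
    fun i => mul_nonneg (sq_nonneg _) (hp i)).1 hvar) i
  rcases mul_eq_zero.1 hzero with h | h
  · exact Or.inl (sub_eq_zero.1 (pow_eq_zero_iff two_ne_zero |>.1 h))
  · exact Or.inr h

/-- equality case of the one-step Lyapunov decrease: if a unit vector
ψ ∈ ℓ²(ℕ,ℂ) satisfies ‖M_g²ψ‖² = ‖M_gψ‖⁴ (written in coordinates, with M_g the diagonal
operator with entries cos(θ+nφ)) and the values cos²(θ+nφ) are pairwise distinct,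
then ψ is a Fock state: ψ = c·e_n for some n and some unimodular c. -/
theorem equality_case_is_fock_state (θ φ : ℝ)
    (hdist : Function.Injective (fun n : ℕ => Real.cos (θ + n * φ) ^ 2))
    (ψ : lp (fun _ : ℕ => ℂ) 2) (hψ : ‖ψ‖ = 1)
    (heq : ∑' n : ℕ, Real.cos (θ + n * φ) ^ 4 * ‖ψ n‖ ^ 2
         = (∑' n : ℕ, Real.cos (θ + n * φ) ^ 2 * ‖ψ n‖ ^ 2) ^ 2) :
    ∃ (n : ℕ) (c : ℂ), ‖c‖ = 1 ∧ ψ = c • lp.single 2 n (1 : ℂ) := by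
  have hsum : HasSum (fun n => ‖ψ n‖ ^ 2) 1 := by
    simpa [hψ] using lp.hasSum_norm (p := 2) (by norm_num) ψ
  have key := eq_tsum_or_eq_zero_of_tsum_sq_eq (a := fun n : ℕ => Real.cos (θ + n * φ) ^ 2)
    (C := 1) (fun n => by simpa using Real.abs_cos_le_one _) (fun n => sq_nonneg ‖ψ n‖) hsum
    (by simpa only [← pow_mul] using heq)
  obtain ⟨n, hn⟩ : ∃ n, ψ n ≠ 0 := by
    by_contra! h
    have hψ0 : ψ = 0 := lp.ext (funext h)
    simp [hψ0] at hψ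
  have hoff : ∀ k, k ≠ n → ψ k = 0 := by
    intro k hk
    have hmean := (key n).resolve_right (by simpa using hn)
    rcases key k with h | h
    · exact absurd (hdist (h.trans hmean.symm)) hk
    · simpa using h
  have hsingle : ψ = ψ n • lp.single 2 n (1 : ℂ) := by
    refine lp.ext (funext fun k => ?_)
    by_cases hk : k = n
    · subst hk
      simp
    · simp [hoff k hk, Pi.single_eq_of_ne hk]
  refine ⟨n, ψ n, ?_, hsingle⟩
  rw [hsingle, norm_smul, lp.norm_single (by norm_num)] at hψ
  simpa using hψ
end
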